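/- For any graph G with maximum degree at most Δ and matching number at most ν (with Δ, ν ≥ 1), the number of edges of G is at most νΔ + ⌊Δ/2⌋ · ⌊ν / ⌈Δ/2⌉ ⌋. -/

import Mathlib

/-- `M` is a matching in `G`: a set of edges of `G` that are pairwise vertex-disjoint. -/
def IsMatchingIn {V : Type*} (G : SimpleGraph V) (M : Finset (Sym2 V)) : Prop :=
  (∀ e ∈ M, e ∈ G.edgeSet) ∧
    (M : Set (Sym2 V)).Pairwise fun e f => ∀ v, ¬(v ∈ e ∧ v ∈ f)

/-- A Tutte-Berge type decomposition yields the edge bound. -/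
theorem ch_count {V κ : Type*} [Fintype V] [DecidableEq V] [Fintype κ] [DecidableEq κ]
    (G : SimpleGraph V) [DecidableRel G.Adj] (D n : ℕ) (hD : 1 ≤ D)
    (hdeg : ∀ v, G.degree v ≤ D) (f : V → Option κ)
    (hf : ∀ v w a b, G.Adj v w → f v = some a → f w = some b → a = b)
    (hs : (Finset.univ.filter (fun v => f v = none)).card +
      ∑ a, (Finset.univ.filter (fun v => f v = some a)).card / 2 ≤ n) :
    G.edgeFinset.card ≤ n * D + (D / 2) * (n / ((D + 1) / 2)) := by
  classical
  set U := Finset.univ.filter (fun v => f v = none) with hU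
  set k : κ → ℕ := fun a => (Finset.univ.filter (fun v => f v = some a)).card / 2 with hk
  change U.card + ∑ a, k a ≤ n at hs
  let H : κ → SimpleGraph V := fun a =>
    { Adj := fun v w => G.Adj v w ∧ f v = some a ∧ f w = some a
      symm := ⟨fun v w h => ⟨h.1.symm, h.2.2, h.2.1⟩⟩
      loopless := ⟨fun v h => G.loopless.irrefl v h.1⟩ }
  have hH : ∀ a, (H a).edgeFinset.card ≤ k a * D + (if (D + 1) / 2 ≤ k a then D / 2 else 0) := by
    intro a
    have h1 := (H a).sum_degrees_eq_twice_card_edges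
    set F := Finset.univ.filter (fun v => f v = some a) with hF
    have h2 : ∑ v, (H a).degree v = ∑ v ∈ F, (H a).degree v := by
      symm
      apply Finset.sum_subset (Finset.subset_univ _)
      intro v _ hv
      rw [SimpleGraph.degree, Finset.card_eq_zero, Finset.eq_empty_iff_forall_notMem]
      intro w hw
      rw [SimpleGraph.mem_neighborFinset] at hw
      exact hv (by simp [hF, hw.2.1])
    have h3 : ∑ v ∈ F, (H a).degree v ≤ F.card * D := by
      rw [← smul_eq_mul]
      apply Finset.sum_le_card_nsmul
      intro v _
      refine le_trans ?_ (hdeg v)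
      apply Finset.card_le_card
      intro w hw
      rw [SimpleGraph.mem_neighborFinset] at hw ⊢
      exact hw.1
    have h4 : ∑ v ∈ F, (H a).degree v ≤ F.card * (F.card - 1) := by
      rw [← smul_eq_mul]
      apply Finset.sum_le_card_nsmul
      intro v hv
      rw [← Finset.card_erase_of_mem hv]
      apply Finset.card_le_card
      intro w hw
      rw [SimpleGraph.mem_neighborFinset] at hw
      exact Finset.mem_erase.2 ⟨hw.1.ne.symm, by simp [hF, hw.2.2]⟩
    have hka : k a = F.card / 2 := rfl
    rw [hka]
    rw [h2] at h1
    rw [h1] at h3 h4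
    generalize (H a).edgeFinset.card = e at *
    rcases Nat.even_or_odd' F.card with ⟨c, hc | hc⟩
    · rw [hc] at h3 ⊢
      have : 2 * c / 2 = c := by omega
      rw [this]
      have : e ≤ c * D := by nlinarith
      omega
    · rw [hc] at h3 h4 ⊢
      have : (2 * c + 1) / 2 = c := by omega
      rw [this]
      split_ifs with hif
      · have : (2 * c + 1) * D = 2 * (c * D) + D := by ring
        omega
      · have h5 : 2 * c + 1 ≤ D := by omega
        have h6 : (2 * c + 1) * (2 * c + 1 - 1) = 2 * (c * (2 * c + 1)) := by
          rw [Nat.add_sub_cancel]; ring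
        have := Nat.mul_le_mul_left c h5
        omega
  have hcover : G.edgeFinset ⊆ (U.biUnion fun v => G.incidenceFinset v) ∪
      (Finset.univ.biUnion fun a => (H a).edgeFinset) := by
    intro e
    induction e using Sym2.ind with
    | _ v w =>
      intro he
      rw [SimpleGraph.mem_edgeFinset, SimpleGraph.mem_edgeSet] at he
      rw [Finset.mem_union, Finset.mem_biUnion, Finset.mem_biUnion]
      rcases hv : f v with _ | a
      · left; exact ⟨v, by simp [hU, hv], by simp [SimpleGraph.incidenceSet, he]⟩
      rcases hw : f w with _ | b
      · left; exact ⟨w, by simp [hU, hw], by simp [SimpleGraph.incidenceSet, he]⟩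
      right
      have := hf v w a b he hv hw
      subst this
      refine ⟨a, Finset.mem_univ _, ?_⟩
      rw [SimpleGraph.mem_edgeFinset, SimpleGraph.mem_edgeSet]
      exact ⟨he, hv, hw⟩
  have h1 : (U.biUnion fun v => G.incidenceFinset v).card ≤ U.card * D := by
    apply Finset.card_biUnion_le_card_mul
    intro v _
    rw [SimpleGraph.card_incidenceFinset_eq_degree]
    exact hdeg v
  have h2 : (Finset.univ.biUnion fun a => (H a).edgeFinset).card ≤
      ∑ a, (k a * D + (if (D + 1) / 2 ≤ k a then D / 2 else 0)) :=
    Finset.card_biUnion_le.trans (Finset.sum_le_sum fun a _ => hH a)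
  rw [Finset.sum_add_distrib, ← Finset.sum_mul, ← Finset.sum_filter, Finset.sum_const,
    smul_eq_mul] at h2
  set P := Finset.univ.filter (fun a => (D + 1) / 2 ≤ k a) with hP
  have h3 : P.card ≤ n / ((D + 1) / 2) := by
    rw [Nat.le_div_iff_mul_le (by omega)]
    have h4 : P.card * ((D + 1) / 2) ≤ ∑ a ∈ P, k a := by
      rw [← smul_eq_mul]
      apply Finset.card_nsmul_le_sum
      intro a ha
      exact (Finset.mem_filter.1 ha).2
    have h5 : ∑ a ∈ P, k a ≤ ∑ a, k a :=
      Finset.sum_le_sum_of_subset (Finset.subset_univ _)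
    omega
  have h6 := (Finset.card_le_card hcover).trans (Finset.card_union_le _ _)
  have h7 := Nat.mul_le_mul_right D hs
  have h8 := Nat.mul_le_mul_left (D / 2) h3
  rw [add_mul] at h7
  rw [mul_comm P.card] at h2
  change U.card * D + (∑ a, k a) * D ≤ n * D at h7
  omega

/-- The join of `G` with a complete graph on `d` vertices. -/
def chJoin {V : Type*} (G : SimpleGraph V) (d : ℕ) : SimpleGraph (V ⊕ Fin d) where
  Adj x y := x ≠ y ∧ ∀ v w, x = Sum.inl v → y = Sum.inl w → G.Adj v w
  symm := ⟨fun _ _ h => ⟨h.1.symm, fun v w hv hw => (h.2 w v hw hv).symm⟩⟩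
  loopless := ⟨fun _ h => h.1 rfl⟩

/-- A perfect matching of the join gives a large matching of `G`. -/
theorem ch_matching {V : Type*} [Fintype V] [DecidableEq V]
    (G : SimpleGraph V) (d n : ℕ)
    (hmatch : ∀ M : Finset (Sym2 V), IsMatchingIn G M → M.card ≤ n)
    (M : (chJoin G d).Subgraph) (hM : M.IsPerfectMatching) :
    Fintype.card V ≤ 2 * n + d := by
  classical
  let H : SimpleGraph V :=
    { Adj := fun v w => M.Adj (Sum.inl v) (Sum.inl w)
      symm := ⟨fun v w h => M.adj_symm h⟩
      loopless := ⟨fun v h => M.adj_sub h |>.1 rfl⟩ }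
  have huniq : ∀ v w w', H.Adj v w → H.Adj v w' → w = w' := fun v w w' h h' =>
    Sum.inl_injective (hM.1.eq_of_adj_left h h')
  have hm : IsMatchingIn G H.edgeFinset := by
    constructor
    · intro e
      induction e using Sym2.ind with
      | _ v w =>
        intro he
        rw [SimpleGraph.mem_edgeFinset, SimpleGraph.mem_edgeSet] at he
        exact (M.adj_sub he).2 v w rfl rfl
    · intro e he e' he' hne v ⟨hv, hv'⟩
      obtain ⟨w, rfl⟩ := hv
      obtain ⟨w', rfl⟩ := hv'
      rw [Finset.mem_coe, SimpleGraph.mem_edgeFinset, SimpleGraph.mem_edgeSet] at he he'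
      exact hne (by rw [huniq v w w' he he'])
  have h1 := hmatch _ hm
  have h2 := H.sum_degrees_eq_twice_card_edges
  let A : Finset V := Finset.univ.filter (fun v => ∃ w, H.Adj v w)
  have h3 : A.card ≤ ∑ v, H.degree v := by
    calc A.card = ∑ v ∈ A, 1 := by simp
      _ ≤ ∑ v ∈ A, H.degree v := Finset.sum_le_sum fun v hv => by
          obtain ⟨w, hw⟩ := (Finset.mem_filter.1 hv).2
          exact (H.degree_pos_iff_exists_adj v).2 ⟨w, hw⟩
      _ ≤ _ := Finset.sum_le_sum_of_subset (Finset.subset_univ _)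
  have h4 : ∀ v ∈ Aᶜ, ∃ i : Fin d, M.Adj (Sum.inl v) (Sum.inr i) := by
    intro v hv
    obtain ⟨x, hx, -⟩ := hM.1 (hM.2 (Sum.inl v))
    rcases x with w | i
    · have hv2 : ∀ w, ¬ H.Adj v w := by simpa [A] using hv
      exact absurd hx (hv2 w)
    · exact ⟨i, hx⟩
  have h5 : Aᶜ.card ≤ d := by
    rcases Nat.eq_zero_or_pos d with rfl | hd
    · rw [Nat.le_zero, Finset.card_eq_zero, Finset.eq_empty_iff_forall_notMem]
      intro v hv
      obtain ⟨i, -⟩ := h4 v hv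
      exact i.elim0
    have : Nonempty (Fin d) := ⟨⟨0, hd⟩⟩
    choose! g hg using h4
    have : Aᶜ.card ≤ (Finset.univ : Finset (Fin d)).card := by
      apply Finset.card_le_card_of_injOn g (fun _ _ => by simp)
      intro v hv w hw h
      have e1 := hg v hv
      have e2 := hg w hw
      rw [h] at e1
      exact Sum.inl_injective (hM.1.eq_of_adj_right e1 e2)
    simpa using this
  have h6 := Finset.card_add_card_compl A
  omega

theorem ch_fiber {V κ : Type*} [Fintype V] [Fintype κ] [DecidableEq κ] (f : V → Option κ) :
    (Finset.univ.filter (fun v => f v = none)).card +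
      ∑ a, (Finset.univ.filter (fun v => f v = some a)).card = Fintype.card V := by
  classical
  have := Finset.card_eq_sum_card_fiberwise (f := f) (s := Finset.univ) (t := Finset.univ)
    (fun _ _ => by simp)
  rw [Fintype.sum_option] at this
  rw [← this, Finset.card_univ]

theorem ch_berge.{u} {V : Type u} [Fintype V] [DecidableEq V]
    (G : SimpleGraph V) (n : ℕ)
    (hmatch : ∀ M : Finset (Sym2 V), IsMatchingIn G M → M.card ≤ n)
    (hN : 2 * n + 2 ≤ Fintype.card V) :
    ∃ (κ : Type u) (_ : Fintype κ) (_ : DecidableEq κ) (f : V → Option κ),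
      (∀ v w a b, G.Adj v w → f v = some a → f w = some b → a = b) ∧
      (Finset.univ.filter (fun v => f v = none)).card +
      ∑ a, (Finset.univ.filter (fun v => f v = some a)).card / 2 ≤ n := by
  classical
  obtain ⟨d, hd⟩ := Nat.exists_eq_add_of_le hN
  have hcard : Nat.card (V ⊕ Fin d) = Fintype.card V + d := by simp
  have heven : Even (Nat.card (V ⊕ Fin d)) := by
    rw [hcard, hd]; exact ⟨n + 1 + d, by ring⟩
  obtain ⟨S, hS⟩ := SimpleGraph.exists_isTutteViolator (G := chJoin G d)
    (fun M hM => by have := ch_matching G d n hmatch M hM; omega) heven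
  unfold SimpleGraph.IsTutteViolator at hS
  set K := ((⊤ : (chJoin G d).Subgraph).deleteVerts S).coe with hK
  have hmem : ∀ x, x ∈ ((⊤ : (chJoin G d).Subgraph).deleteVerts S).verts ↔ x ∉ S := by
    intro x; simp
  have hpar := SimpleGraph.odd_ncard_oddComponents K
  have hcS : Nat.card ((⊤ : (chJoin G d).Subgraph).deleteVerts S).verts + S.ncard
      = Fintype.card V + d := by
    have e : ((⊤ : (chJoin G d).Subgraph).deleteVerts S).verts = Sᶜ := by
      ext x; simp
    rw [Nat.card_coe_set_eq, e, add_comm, Set.ncard_add_ncard_compl, hcard]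
  have hodd2 : S.ncard + 2 ≤ K.oddComponents.ncard := by
    rw [Nat.odd_iff, Nat.odd_iff] at hpar
    omega
  have hadj : ∀ x y (hx : x ∉ S) (hy : y ∉ S), (chJoin G d).Adj x y →
      K.Adj ⟨x, (hmem x).2 hx⟩ ⟨y, (hmem y).2 hy⟩ := by
    intro x y hx hy h
    simp [hK, hx, hy, h]
  have hinr : ∀ i : Fin d, Sum.inr i ∈ S := by
    intro i
    by_contra hi
    have : K.oddComponents.ncard ≤ 1 := by
      rw [Set.ncard_le_one_iff]
      have key : ∀ a : K.ConnectedComponent,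
          a = K.connectedComponentMk ⟨Sum.inr i, (hmem _).2 hi⟩ := by
        intro a
        induction a using SimpleGraph.ConnectedComponent.ind with
        | _ x =>
          obtain ⟨x, hx⟩ := x
          rw [SimpleGraph.ConnectedComponent.eq]
          by_cases hxi : x = Sum.inr i
          · subst hxi; exact SimpleGraph.Reachable.refl _
          · apply SimpleGraph.Adj.reachable
            apply hadj x _ ((hmem x).1 hx) hi
            exact ⟨hxi, fun v w _ h => by simp at h⟩
      intro a b _ _
      rw [key a, key b]
    omega
  let f : V → Option K.ConnectedComponent := fun v =>
    if h : Sum.inl v ∈ S then none else some (K.connectedComponentMk ⟨Sum.inl v, (hmem _).2 h⟩)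
  have : Finite K.ConnectedComponent := Quot.finite _
  let _ : Fintype K.ConnectedComponent := Fintype.ofFinite _
  refine ⟨K.ConnectedComponent, inferInstance, inferInstance, f, ?_, ?_⟩
  · intro v w a b h hv hw
    by_cases h1 : Sum.inl v ∈ S
    · simp [f, h1] at hv
    by_cases h2 : Sum.inl w ∈ S
    · simp [f, h2] at hw
    simp only [f, h1, h2, dite_false, Option.some.injEq] at hv hw
    rw [← hv, ← hw, SimpleGraph.ConnectedComponent.eq]
    apply SimpleGraph.Adj.reachable
    apply hadj _ _ h1 h2
    refine ⟨fun e => h.ne (Sum.inl_injective e), fun v' w' e1 e2 => ?_⟩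
    rw [← Sum.inl_injective e1, ← Sum.inl_injective e2]
    exact h
  · have hfib := ch_fiber f
    have hSc : (Finset.univ.filter (fun v => f v = none)).card + d = S.ncard := by
      have e : S.toFinset = (Finset.univ.filter (fun v => f v = none)).disjSum
          (Finset.univ : Finset (Fin d)) := by
        ext x
        rcases x with v | i
        · by_cases h : Sum.inl v ∈ S <;> simp [f, h]
        · simp [hinr i]
      rw [Set.ncard_eq_toFinset_card', e, Finset.card_disjSum]
      simp
    have hsupp : ∀ a : K.ConnectedComponent, a.supp.ncard =
        (Finset.univ.filter (fun v => f v = some a)).card := by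
      intro a
      rw [← Set.ncard_coe_finset, ← Set.ncard_image_of_injective _ Subtype.val_injective,
        ← Set.ncard_image_of_injective
          (↑(Finset.univ.filter (fun v => f v = some a)) : Set V)
          (Sum.inl_injective (β := Fin d))]
      congr 1
      ext x
      rcases x with v | i
      · by_cases h : Sum.inl v ∈ S <;> simp [f, h]
      · simp [hinr i]
    have hodd : K.oddComponents.ncard =
        ∑ a, (Finset.univ.filter (fun v => f v = some a)).card % 2 := by
      have e : K.oddComponents.toFinset = Finset.univ.filter
          (fun a => Odd (Finset.univ.filter (fun v => f v = some a)).card) := by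
        ext a
        simp [SimpleGraph.oddComponents, ← hsupp]
      rw [Set.ncard_eq_toFinset_card', e, Finset.card_filter]
      apply Finset.sum_congr rfl
      intro a _
      split_ifs with h
      · exact (Nat.odd_iff.1 h).symm
      · exact (Nat.even_iff.1 (Nat.not_odd_iff_even.1 h)).symm
    have hdm : ∑ a, (Finset.univ.filter (fun v => f v = some a)).card =
        ∑ a, (Finset.univ.filter (fun v => f v = some a)).card % 2 +
        2 * ∑ a, (Finset.univ.filter (fun v => f v = some a)).card / 2 := by
      rw [Finset.mul_sum, ← Finset.sum_add_distrib]
      apply Finset.sum_congr rfl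
      intro a _
      omega
    omega

/-- Chvátal–Hanson theorem: if `Δ(G) ≤ D` and `ν(G) ≤ n` (`D, n ≥ 1`), then
`e(G) ≤ n·D + ⌊D/2⌋·⌊n/⌈D/2⌉⌋`. -/
theorem stmt4 {V : Type*} [Fintype V] [DecidableEq V]
    (G : SimpleGraph V) [DecidableRel G.Adj] (D n : ℕ) (hD : 1 ≤ D) (hn : 1 ≤ n)
    (hdeg : ∀ v, G.degree v ≤ D)
    (hmatch : ∀ M : Finset (Sym2 V), IsMatchingIn G M → M.card ≤ n) :
    G.edgeFinset.card ≤ n * D + (D / 2) * (n / ((D + 1) / 2)) := by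
  by_cases hN : 2 * n + 2 ≤ Fintype.card V
  · obtain ⟨κ, _, _, f, hf, hs⟩ := ch_berge G n hmatch hN
    exact ch_count G D n hD hdeg f hf hs
  · refine ch_count G D n hD hdeg (fun _ => some ()) (fun _ _ _ _ _ _ _ => rfl) ?_
    simp
    omega
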